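/- Let k, m ≥ 1, T > 0, let a_1, …, a_{k+m} and b_1, …, b_{k+m} be nonzero real numbers, and let C = (c_{ij}) be a real k × m matrix. Let u_1, …, u_k, v_1, …, v_m : ℝ × ℝ → ℝ be smooth, with ∂_t u_i = ∂_x^5 u_i for all x ≤ 0 and t ∈ [0,T], ∂_t v_j = ∂_x^5 v_j for all x ≥ 0 and t ∈ [0,T], each u_i having left-decay of order 5 on [0,T] and each v_j having right-decay of order 5 on [0,T], and suppose the Kawahara vertex conditions with data (a, b, C) hold on [0,T]. Then for every T' ∈ [0,T]: Σ_{i=1}^k ∫_{-∞}^0 u_i(x,T')^2 dx + Σ_{j=1}^m ∫_0^{∞} v_j(x,T')^2 dx − Σ_{i=1}^k ∫_{-∞}^0 u_i(x,0)^2 dx − Σ_{j=1}^m ∫_0^{∞} v_j(x,0)^2 dx = ∫_0^{T'} [ Σ_{i=1}^k ( Σ_{j=1}^m c_{ij} ∂_x^2 v_j(0,t) )^2 − Σ_{j=1}^m ( ∂_x^2 v_j(0,t) )^2 ] dt. -/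

import Mathlib

open MeasureTheory Set Matrix

/-- `k`-th partial derivative in the first (space) variable of `w : ℝ × ℝ → ℝ`. -/
noncomputable def pdx (k : ℕ) (w : ℝ × ℝ → ℝ) (x t : ℝ) : ℝ :=
  iteratedDeriv k (fun y => w (y, t)) x

/-- Partial derivative in the second (time) variable of `w : ℝ × ℝ → ℝ`. -/
noncomputable def pdt (w : ℝ × ℝ → ℝ) (x t : ℝ) : ℝ :=
  deriv (fun s => w (x, s)) t

/-- `w` has left-decay of order 5 on `[0,T]`. -/
def LeftDecay5 (w : ℝ × ℝ → ℝ) (T : ℝ) : Prop :=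
  ∃ C > (0:ℝ), ∀ k ≤ 5, ∀ t ∈ Icc (0:ℝ) T, ∀ x ≤ (0:ℝ),
    |pdx k w x t| ≤ C * (1 + x ^ 2)⁻¹

/-- `w` has right-decay of order 5 on `[0,T]`. -/
def RightDecay5 (w : ℝ × ℝ → ℝ) (T : ℝ) : Prop :=
  ∃ C > (0:ℝ), ∀ k ≤ 5, ∀ t ∈ Icc (0:ℝ) T, ∀ x : ℝ, 0 ≤ x →
    |pdx k w x t| ≤ C * (1 + x ^ 2)⁻¹

/-- The Kawahara vertex conditions with data `(a, b, C)` on `[0,T]`,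
for the edge functions `u i` (edges `(-∞,0)`) and `v j` (edges `(0,∞)`).
The distinguished first edge is `u ⟨0, hk⟩`. -/
def KawaharaVertexConditions (k m : ℕ) (hk : 0 < k) (T : ℝ)
    (a b : Fin (k + m) → ℝ) (C : Matrix (Fin k) (Fin m) ℝ)
    (u : Fin k → ℝ × ℝ → ℝ) (v : Fin m → ℝ × ℝ → ℝ) : Prop :=
  ∀ t ∈ Icc (0:ℝ) T,
    (∀ i : Fin k, u ⟨0, hk⟩ (0, t) = a (Fin.castAdd m i) * u i (0, t)) ∧
    (∀ j : Fin m, u ⟨0, hk⟩ (0, t) = a (Fin.natAdd k j) * v j (0, t)) ∧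
    (∀ i : Fin k, pdx 1 (u ⟨0, hk⟩) 0 t = b (Fin.castAdd m i) * pdx 1 (u i) 0 t) ∧
    (∀ j : Fin m, pdx 1 (u ⟨0, hk⟩) 0 t = b (Fin.natAdd k j) * pdx 1 (v j) 0 t) ∧
    (∀ i : Fin k, pdx 2 (u i) 0 t = ∑ j : Fin m, C i j * pdx 2 (v j) 0 t) ∧
    (∑ i : Fin k, (b (Fin.castAdd m i))⁻¹ * pdx 3 (u i) 0 t
      = ∑ j : Fin m, (b (Fin.natAdd k j))⁻¹ * pdx 3 (v j) 0 t) ∧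
    (∑ i : Fin k, (a (Fin.castAdd m i))⁻¹ * pdx 4 (u i) 0 t
      = ∑ j : Fin m, (a (Fin.natAdd k j))⁻¹ * pdx 4 (v j) 0 t)

open Filter Topology

/-- Each space derivative of a smooth function is jointly smooth in `(x, t)`. -/
lemma contDiff_pdx {w : ℝ × ℝ → ℝ} (hw : ContDiff ℝ (⊤ : ℕ∞) w) (k : ℕ) :
    ContDiff ℝ (⊤ : ℕ∞) (fun p : ℝ × ℝ => pdx k w p.1 p.2) := by
  induction k with
  | zero => simpa [pdx] using hw
  | succ k ih =>
    have h : (fun p : ℝ × ℝ => pdx (k + 1) w p.1 p.2)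
        = fun p => fderiv ℝ (fun q : ℝ × ℝ => pdx k w q.1 q.2) p (1, 0) := by
      ext ⟨x, t⟩
      have hd := (ih.differentiable (by simp) (x, t)).hasFDerivAt.comp_hasDerivAt x
        ((hasDerivAt_id x).prodMk (hasDerivAt_const x t))
      change iteratedDeriv (k + 1) (fun y => w (y, t)) x = _
      rw [iteratedDeriv_succ]
      exact hd.deriv
    rw [h]
    exact (ih.fderiv_right (m := (⊤ : ℕ∞)) (by simp)).clm_apply contDiff_const

lemma hasDerivAt_pdx {w : ℝ × ℝ → ℝ} (hw : ContDiff ℝ (⊤ : ℕ∞) w) (k : ℕ) (x t : ℝ) :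
    HasDerivAt (fun y => pdx k w y t) (pdx (k + 1) w x t) x := by
  have hd : Differentiable ℝ (fun y => pdx k w y t) :=
    ((contDiff_pdx hw k).differentiable (by simp)).comp
      (differentiable_id.prodMk (differentiable_const t))
  have h : pdx (k + 1) w x t = deriv (fun y => pdx k w y t) x := by
    change iteratedDeriv (k + 1) (fun y => w (y, t)) x = _
    rw [iteratedDeriv_succ]
    rfl
  rw [h]
  exact (hd x).hasDerivAt

lemma hasDerivAt_pdt {w : ℝ × ℝ → ℝ} (hw : ContDiff ℝ (⊤ : ℕ∞) w) (x t : ℝ) :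
    HasDerivAt (fun s => w (x, s)) (pdt w x t) t :=
  ((hw.differentiable (by simp)).comp
    ((differentiable_const x).prodMk differentiable_id) t).hasDerivAt

/-- The space antiderivative of `2 * w * ∂ₓ⁵ w`. -/
noncomputable def energyFlux (w : ℝ × ℝ → ℝ) (x t : ℝ) : ℝ :=
  2 * (pdx 0 w x t * pdx 4 w x t) - 2 * (pdx 1 w x t * pdx 3 w x t) + pdx 2 w x t ^ 2

lemma hasDerivAt_energyFlux {w : ℝ × ℝ → ℝ} (hw : ContDiff ℝ (⊤ : ℕ∞) w) (x t : ℝ) :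
    HasDerivAt (fun y => energyFlux w y t) (2 * (pdx 0 w x t * pdx 5 w x t)) x := by
  have h := ((((hasDerivAt_pdx hw 0 x t).mul (hasDerivAt_pdx hw 4 x t)).const_mul 2).sub
    (((hasDerivAt_pdx hw 1 x t).mul (hasDerivAt_pdx hw 3 x t)).const_mul 2)).add
    ((hasDerivAt_pdx hw 2 x t).pow 2)
  refine h.congr_deriv ?_
  norm_num
  ring

lemma continuous_energyFlux {w : ℝ × ℝ → ℝ} (hw : ContDiff ℝ (⊤ : ℕ∞) w) (x : ℝ) :
    Continuous (fun t => energyFlux w x t) := by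
  have h (k : ℕ) : Continuous (fun t => pdx k w x t) :=
    (contDiff_pdx hw k).continuous.comp (Continuous.prodMk_right x)
  exact (((h 0).mul (h 4)).const_mul 2 |>.sub (((h 1).mul (h 3)).const_mul 2)).add ((h 2).pow 2)

lemma abs_mul_le_of_abs_le_inv_one_add_sq {C p q x : ℝ} (hC : 0 < C)
    (hp : |p| ≤ C * (1 + x ^ 2)⁻¹) (hq : |q| ≤ C * (1 + x ^ 2)⁻¹) :
    |p * q| ≤ C ^ 2 * (1 + x ^ 2)⁻¹ := by
  have h0 : 0 ≤ (1 + x ^ 2)⁻¹ := by positivity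
  have h1 : (1 + x ^ 2)⁻¹ ≤ 1 := inv_le_one_of_one_le₀ (by nlinarith [sq_nonneg x])
  have hq' : |q| ≤ C := hq.trans (mul_le_of_le_one_right hC.le h1)
  rw [abs_mul]
  calc |p| * |q| ≤ (C * (1 + x ^ 2)⁻¹) * C := by gcongr
    _ = C ^ 2 * (1 + x ^ 2)⁻¹ := by ring

lemma tendsto_energyFlux {w : ℝ × ℝ → ℝ} {l : Filter ℝ} {C t : ℝ}
    (hl : Tendsto (fun x : ℝ => x ^ 2) l atTop)
    (hdec : ∀ k ≤ 5, ∀ᶠ x in l, |pdx k w x t| ≤ C * (1 + x ^ 2)⁻¹) :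
    Tendsto (fun x => energyFlux w x t) l (𝓝 0) := by
  have hg : Tendsto (fun x : ℝ => C * (1 + x ^ 2)⁻¹) l (𝓝 0) := by
    simpa using (tendsto_inv_atTop_zero.comp (tendsto_atTop_add_const_left l 1 hl)).const_mul C
  have h (k : ℕ) (hk : k ≤ 5) : Tendsto (fun x => pdx k w x t) l (𝓝 0) :=
    squeeze_zero_norm' (hdec k hk) hg
  simpa [energyFlux] using ((((h 0 (by norm_num)).mul (h 4 (by norm_num))).const_mul 2).sub
    (((h 1 (by norm_num)).mul (h 3 (by norm_num))).const_mul 2)).add ((h 2 (by norm_num)).pow 2)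

section Decay

variable {w : ℝ × ℝ → ℝ} {S : Set ℝ} {C T : ℝ}

lemma integrableOn_pdx_mul_pdx (hw : ContDiff ℝ (⊤ : ℕ∞) w) (hS : MeasurableSet S) (hC : 0 < C)
    (hdec : ∀ k ≤ 5, ∀ t ∈ Icc (0:ℝ) T, ∀ x ∈ S, |pdx k w x t| ≤ C * (1 + x ^ 2)⁻¹)
    {i j : ℕ} (hi : i ≤ 5) (hj : j ≤ 5) {t : ℝ} (ht : t ∈ Icc (0:ℝ) T) :
    IntegrableOn (fun x => pdx i w x t * pdx j w x t) S := by
  have hc (k : ℕ) : Continuous (fun x => pdx k w x t) :=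
    (contDiff_pdx hw k).continuous.comp (Continuous.prodMk_left t)
  refine (integrable_inv_one_add_sq.const_mul (C ^ 2)).integrableOn.mono'
    ((hc i).mul (hc j)).aestronglyMeasurable ?_
  filter_upwards [ae_restrict_mem hS] with x hx
  exact abs_mul_le_of_abs_le_inv_one_add_sq hC (hdec i hi t ht x hx) (hdec j hj t ht x hx)

/-- The energy on `S` changes at the rate `∫ x in S, 2 * w * ∂ₓ⁵ w`. -/
lemma integral_sq_sub_integral_sq (hw : ContDiff ℝ (⊤ : ℕ∞) w) (hS : MeasurableSet S)
    (hC : 0 < C)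
    (hdec : ∀ k ≤ 5, ∀ t ∈ Icc (0:ℝ) T, ∀ x ∈ S, |pdx k w x t| ≤ C * (1 + x ^ 2)⁻¹)
    (heq : ∀ x ∈ S, ∀ t ∈ Icc (0:ℝ) T, pdt w x t = pdx 5 w x t)
    {T' : ℝ} (hT' : T' ∈ Icc (0:ℝ) T) :
    (∫ x in S, w (x, T') ^ 2) - ∫ x in S, w (x, 0) ^ 2
      = ∫ t in (0:ℝ)..T', ∫ x in S, 2 * (pdx 0 w x t * pdx 5 w x t) := by
  have hsub : uIcc 0 T' ⊆ Icc 0 T := by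
    rw [uIcc_of_le hT'.1]
    exact Icc_subset_Icc_right hT'.2
  have hsub' : uIoc 0 T' ⊆ Icc 0 T := uIoc_subset_uIcc.trans hsub
  have hcont : Continuous (fun p : ℝ × ℝ => 2 * (pdx 0 w p.1 p.2 * pdx 5 w p.1 p.2)) :=
    ((contDiff_pdx hw 0).continuous.mul (contDiff_pdx hw 5).continuous).const_mul 2
  have hsq (t : ℝ) (ht : t ∈ Icc (0:ℝ) T) : IntegrableOn (fun x => w (x, t) ^ 2) S := by
    simpa [pdx, sq] using
      integrableOn_pdx_mul_pdx hw hS hC hdec (i := 0) (j := 0) (by simp) (by simp) ht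
  have hint : Integrable
      (Function.uncurry fun t x => 2 * (pdx 0 w x t * pdx 5 w x t))
      ((volume.restrict (uIoc 0 T')).prod (volume.restrict S)) := by
    have hbound : Integrable (fun p : ℝ × ℝ => (1:ℝ) * (2 * C ^ 2 * (1 + p.2 ^ 2)⁻¹))
        ((volume.restrict (uIoc 0 T')).prod (volume.restrict S)) := by
      refine Integrable.mul_prod (f := fun _ : ℝ => (1:ℝ))
        (g := fun x : ℝ => 2 * C ^ 2 * (1 + x ^ 2)⁻¹) ?_ ?_
      · exact integrableOn_const (by simp [uIoc])
      · exact (integrable_inv_one_add_sq.const_mul _).integrableOn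
    refine hbound.mono' (hcont.comp continuous_swap).aestronglyMeasurable ?_
    rw [Measure.prod_restrict]
    filter_upwards [ae_restrict_mem (measurableSet_uIoc.prod hS)] with ⟨t, x⟩ ⟨ht, hx⟩
    have h := abs_mul_le_of_abs_le_inv_one_add_sq hC
      (hdec 0 (by simp) t (hsub' ht) x hx) (hdec 5 le_rfl t (hsub' ht) x hx)
    simp only [Function.uncurry_apply_pair, Real.norm_eq_abs]
    rw [abs_mul, abs_two]
    linarith
  rw [intervalIntegral_integral_swap hint,
    ← integral_sub (hsq T' hT') (hsq 0 ⟨le_rfl, hT'.1.trans hT'.2⟩)]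
  refine setIntegral_congr_fun hS fun x hx => ?_
  refine (intervalIntegral.integral_eq_sub_of_hasDerivAt (f := fun t => w (x, t) ^ 2)
    (f' := fun t => 2 * (pdx 0 w x t * pdx 5 w x t)) (fun t ht => ?_)
    ((hcont.comp (Continuous.prodMk_right x)).intervalIntegrable _ _)).symm
  refine ((hasDerivAt_pdt hw x t).pow 2).congr_deriv ?_
  rw [heq x hx t (hsub ht)]
  simp [pdx, mul_assoc]

end Decay

lemma integral_Iic_sq_sub_eq_energyFlux {w : ℝ × ℝ → ℝ} {T : ℝ}
    (hw : ContDiff ℝ (⊤ : ℕ∞) w) (hdec : LeftDecay5 w T)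
    (heq : ∀ x ≤ (0:ℝ), ∀ t ∈ Icc (0:ℝ) T, pdt w x t = pdx 5 w x t)
    {T' : ℝ} (hT' : T' ∈ Icc (0:ℝ) T) :
    (∫ x in Iic (0:ℝ), w (x, T') ^ 2) - ∫ x in Iic (0:ℝ), w (x, 0) ^ 2
      = ∫ t in (0:ℝ)..T', energyFlux w 0 t := by
  obtain ⟨C, hC, hdec⟩ := hdec
  rw [integral_sq_sub_integral_sq hw measurableSet_Iic hC hdec heq hT']
  refine intervalIntegral.integral_congr fun t ht => ?_
  rw [uIcc_of_le hT'.1] at ht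
  have ht' : t ∈ Icc (0:ℝ) T := ⟨ht.1, ht.2.trans hT'.2⟩
  have hsq : Tendsto (fun x : ℝ => x ^ 2) atBot atTop := by
    simpa [Function.comp_def] using
      (tendsto_pow_atTop (α := ℝ) two_ne_zero).comp tendsto_abs_atBot_atTop
  have h := integral_Iic_of_hasDerivAt_of_tendsto' (a := (0:ℝ))
    (fun x _ => hasDerivAt_energyFlux hw x t)
    ((integrableOn_pdx_mul_pdx hw measurableSet_Iic hC hdec (by simp) le_rfl ht').const_mul 2)
    (tendsto_energyFlux (C := C) hsq
      fun k hk => (eventually_le_atBot 0).mono (hdec k hk t ht'))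
  simpa using h

lemma integral_Ici_sq_sub_eq_neg_energyFlux {w : ℝ × ℝ → ℝ} {T : ℝ}
    (hw : ContDiff ℝ (⊤ : ℕ∞) w) (hdec : RightDecay5 w T)
    (heq : ∀ x : ℝ, 0 ≤ x → ∀ t ∈ Icc (0:ℝ) T, pdt w x t = pdx 5 w x t)
    {T' : ℝ} (hT' : T' ∈ Icc (0:ℝ) T) :
    (∫ x in Ici (0:ℝ), w (x, T') ^ 2) - ∫ x in Ici (0:ℝ), w (x, 0) ^ 2
      = ∫ t in (0:ℝ)..T', -energyFlux w 0 t := by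
  obtain ⟨C, hC, hdec⟩ := hdec
  rw [integral_sq_sub_integral_sq hw measurableSet_Ici hC hdec heq hT']
  refine intervalIntegral.integral_congr fun t ht => ?_
  rw [uIcc_of_le hT'.1] at ht
  have ht' : t ∈ Icc (0:ℝ) T := ⟨ht.1, ht.2.trans hT'.2⟩
  have h := integral_Ioi_of_hasDerivAt_of_tendsto' (a := (0:ℝ))
    (fun x _ => hasDerivAt_energyFlux hw x t)
    (((integrableOn_pdx_mul_pdx hw measurableSet_Ici hC hdec
      (by simp) le_rfl ht').mono_set Ioi_subset_Ici_self).const_mul 2)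
    (tendsto_energyFlux (C := C) (tendsto_pow_atTop two_ne_zero)
      fun k hk => (eventually_ge_atTop 0).mono (hdec k hk t ht'))
  rw [← integral_Ici_eq_integral_Ioi] at h
  simpa using h

/-- A vertex quantity `r = d i * p i` shared by all edges factors out of the sum of `p i * q i`. -/
lemma sum_mul_eq_mul_sum_inv_mul {ι : Type*} [Fintype ι] {d p q : ι → ℝ} {r : ℝ}
    (hd : ∀ i, d i ≠ 0) (h : ∀ i, r = d i * p i) :
    ∑ i, p i * q i = r * ∑ i, (d i)⁻¹ * q i := by
  rw [Finset.mul_sum]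
  refine Finset.sum_congr rfl fun i _ => ?_
  have := hd i
  rw [h i]
  field_simp

lemma sum_energyFlux_sub_sum_energyFlux
    {k m : ℕ} {hk : 0 < k} {T : ℝ} {a b : Fin (k + m) → ℝ}
    (ha : ∀ i, a i ≠ 0) (hb : ∀ i, b i ≠ 0) {C : Matrix (Fin k) (Fin m) ℝ}
    {u : Fin k → ℝ × ℝ → ℝ} {v : Fin m → ℝ × ℝ → ℝ}
    (hvc : KawaharaVertexConditions k m hk T a b C u v) {t : ℝ} (ht : t ∈ Icc (0:ℝ) T) :
    ∑ i, energyFlux (u i) 0 t - ∑ j, energyFlux (v j) 0 t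
      = ∑ i, (∑ j, C i j * pdx 2 (v j) 0 t) ^ 2 - ∑ j, pdx 2 (v j) 0 t ^ 2 := by
  obtain ⟨hau, hav, hbu, hbv, h2, h3, h4⟩ := hvc t ht
  have hu4 := sum_mul_eq_mul_sum_inv_mul (p := fun i => pdx 0 (u i) 0 t)
    (q := fun i => pdx 4 (u i) 0 t) (fun i => ha (Fin.castAdd m i)) hau
  have hv4 := sum_mul_eq_mul_sum_inv_mul (p := fun j => pdx 0 (v j) 0 t)
    (q := fun j => pdx 4 (v j) 0 t) (fun j => ha (Fin.natAdd k j)) hav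
  have hu3 := sum_mul_eq_mul_sum_inv_mul (q := fun i => pdx 3 (u i) 0 t)
    (fun i => hb (Fin.castAdd m i)) hbu
  have hv3 := sum_mul_eq_mul_sum_inv_mul (q := fun j => pdx 3 (v j) 0 t)
    (fun j => hb (Fin.natAdd k j)) hbv
  rw [h4, ← hv4] at hu4
  rw [h3, ← hv3] at hu3
  simp only [energyFlux, Finset.sum_add_distrib, Finset.sum_sub_distrib, ← Finset.mul_sum,
    ← h2, hu4, hu3]
  ring

/-- Energy identity for the linearized Kawahara system on a star graph with
`k` incoming edges `(-∞,0)` and `m` outgoing edges `(0,∞)`. -/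
theorem kawahara_star_energy_identity
    (k m : ℕ) (hk : 0 < k) (hm : 0 < m) (T : ℝ) (hT : 0 < T)
    (a b : Fin (k + m) → ℝ) (ha : ∀ i, a i ≠ 0) (hb : ∀ i, b i ≠ 0)
    (C : Matrix (Fin k) (Fin m) ℝ)
    (u : Fin k → ℝ × ℝ → ℝ) (v : Fin m → ℝ × ℝ → ℝ)
    (hu_smooth : ∀ i, ContDiff ℝ (⊤ : ℕ∞) (u i))
    (hv_smooth : ∀ j, ContDiff ℝ (⊤ : ℕ∞) (v j))
    (hu_eq : ∀ i, ∀ x ≤ (0:ℝ), ∀ t ∈ Icc (0:ℝ) T, pdt (u i) x t = pdx 5 (u i) x t)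
    (hv_eq : ∀ j, ∀ x : ℝ, 0 ≤ x → ∀ t ∈ Icc (0:ℝ) T, pdt (v j) x t = pdx 5 (v j) x t)
    (hu_dec : ∀ i, LeftDecay5 (u i) T)
    (hv_dec : ∀ j, RightDecay5 (v j) T)
    (hvc : KawaharaVertexConditions k m hk T a b C u v) :
    ∀ T' ∈ Icc (0:ℝ) T,
      (∑ i : Fin k, ∫ x in Iic (0:ℝ), (u i (x, T')) ^ 2)
        + (∑ j : Fin m, ∫ x in Ici (0:ℝ), (v j (x, T')) ^ 2)
        - (∑ i : Fin k, ∫ x in Iic (0:ℝ), (u i (x, 0)) ^ 2)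
        - (∑ j : Fin m, ∫ x in Ici (0:ℝ), (v j (x, 0)) ^ 2)
      = ∫ t in (0:ℝ)..T',
          ((∑ i : Fin k, (∑ j : Fin m, C i j * pdx 2 (v j) 0 t) ^ 2)
            - ∑ j : Fin m, (pdx 2 (v j) 0 t) ^ 2) := by
  intro T' hT'
  have hflux {ι : Type} [Fintype ι] (w : ι → ℝ × ℝ → ℝ)
      (hw : ∀ i, ContDiff ℝ (⊤ : ℕ∞) (w i)) :
      Continuous fun t => ∑ i, energyFlux (w i) 0 t :=
    continuous_finsetSum _ fun i _ => continuous_energyFlux (hw i) 0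
  have hu : (∑ i, ∫ x in Iic (0:ℝ), u i (x, T') ^ 2) - ∑ i, ∫ x in Iic (0:ℝ), u i (x, 0) ^ 2
      = ∫ t in (0:ℝ)..T', ∑ i, energyFlux (u i) 0 t := by
    rw [← Finset.sum_sub_distrib, intervalIntegral.integral_finsetSum fun i _ =>
      (continuous_energyFlux (hu_smooth i) 0).intervalIntegrable _ _]
    exact Finset.sum_congr rfl fun i _ =>
      integral_Iic_sq_sub_eq_energyFlux (hu_smooth i) (hu_dec i) (hu_eq i) hT'
  have hv : (∑ j, ∫ x in Ici (0:ℝ), v j (x, T') ^ 2) - ∑ j, ∫ x in Ici (0:ℝ), v j (x, 0) ^ 2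
      = -∫ t in (0:ℝ)..T', ∑ j, energyFlux (v j) 0 t := by
    rw [← Finset.sum_sub_distrib, intervalIntegral.integral_finsetSum fun j _ =>
      (continuous_energyFlux (hv_smooth j) 0).intervalIntegrable _ _, ← Finset.sum_neg_distrib]
    refine Finset.sum_congr rfl fun j _ => ?_
    rw [← intervalIntegral.integral_neg]
    exact integral_Ici_sq_sub_eq_neg_energyFlux (hv_smooth j) (hv_dec j) (hv_eq j) hT'
  have hrhs : ∫ t in (0:ℝ)..T', ((∑ i, (∑ j, C i j * pdx 2 (v j) 0 t) ^ 2)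
        - ∑ j, (pdx 2 (v j) 0 t) ^ 2)
      = (∫ t in (0:ℝ)..T', ∑ i, energyFlux (u i) 0 t)
        - ∫ t in (0:ℝ)..T', ∑ j, energyFlux (v j) 0 t := by
    rw [← intervalIntegral.integral_sub ((hflux u hu_smooth).intervalIntegrable _ _)
      ((hflux v hv_smooth).intervalIntegrable _ _)]
    refine intervalIntegral.integral_congr fun t ht => ?_
    rw [uIcc_of_le hT'.1] at ht
    exact (sum_energyFlux_sub_sum_energyFlux ha hb hvc ⟨ht.1, ht.2.trans hT'.2⟩).symm
  rw [hrhs]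
  linarith
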